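/- Let p be a prime with p ≡ 1 (mod 8), k = ℚ(√p), and let ε be a unit of the ring of integers of k with ε > 0 (in the real embedding sending √p to the positive square root) and norm N_{k/ℚ}(ε) = −1. Then the unique quartic subfield F of ℚ(μ_p) equals k(√(ε√p)), the quadratic extension of k obtained by adjoining a square root of ε√p. -/

import Mathlib

set_option maxHeartbeats 1000000
set_option synthInstance.maxHeartbeats 400000

open NumberField IntermediateField

theorem Subgroup.eq_of_natCard_eq_of_isCyclic {G : Type*} [Group G] [Finite G] [IsCyclic G]
    {H K : Subgroup G} (h : Nat.card H = Nat.card K) : H = K := by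
  classical
  cases nonempty_fintype G
  have key (H : Subgroup G) :
      (H : Set G) = ((Finset.univ.filter fun g : G ↦ g ^ Nat.card H = 1 : Finset G) : Set G) := by
    refine Set.eq_of_subset_of_ncard_le (fun g hg ↦ ?_) ?_ (Set.toFinite _)
    · simpa only [Finset.coe_filter, Finset.mem_univ, true_and] using!
        orderOf_dvd_iff_pow_eq_one.1 (H.orderOf_dvd_natCard hg)
    · rw [Set.ncard_coe_finset]
      exact (IsCyclic.card_pow_eq_one_le Nat.card_pos).trans_eq (Nat.card_coe_set_eq _)
  exact SetLike.coe_injective (by rw [key H, key K, h])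

theorem IntermediateField.eq_of_finrank_eq_of_isCyclic {K L : Type*} [Field K] [Field L]
    [Algebra K L] [FiniteDimensional K L] [IsGalois K L] [IsCyclic Gal(L/K)]
    {E F : IntermediateField K L} (h : Module.finrank K E = Module.finrank K F) : E = F := by
  rw [← IsGalois.fixedField_fixingSubgroup E, ← IsGalois.fixedField_fixingSubgroup F]
  congr 1
  apply Subgroup.eq_of_natCard_eq_of_isCyclic
  rw [IsGalois.card_fixingSubgroup_eq_finrank, IsGalois.card_fixingSubgroup_eq_finrank]
  have hE := Module.finrank_mul_finrank K E L
  have hF := Module.finrank_mul_finrank K F L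
  rw [h, ← hF] at hE
  exact Nat.eq_of_mul_eq_mul_left Module.finrank_pos hE

theorem IsPrimitiveRoot.eq_of_le_adjoin_of_finrank_eq {K L : Type*} [Field K] [Field L]
    [Algebra K L] {p : ℕ} (hp : p.Prime) (hirr : Irreducible (Polynomial.cyclotomic p K)) {ζ : L}
    (hζ : IsPrimitiveRoot ζ p) {E F : IntermediateField K L} (hE : E ≤ K⟮ζ⟯) (hF : F ≤ K⟮ζ⟯)
    (h : Module.finrank K E = Module.finrank K F) : E = F := by
  have : Fact p.Prime := ⟨hp⟩
  have : NeZero p := ⟨hp.ne_zero⟩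
  have : IsCyclotomicExtension {p} K K⟮ζ⟯ := by
    change IsCyclotomicExtension {p} K K⟮ζ⟯.toSubalgebra
    rw [adjoin_simple_toSubalgebra_of_isAlgebraic (hζ.isIntegral hp.pos).tower_top.isAlgebraic]
    exact hζ.adjoin_isCyclotomicExtension K
  have : FiniteDimensional K K⟮ζ⟯ := IsCyclotomicExtension.finiteDimensional {p} K _
  have : IsGalois K K⟮ζ⟯ := IsCyclotomicExtension.isGalois {p} K _
  have : IsCyclic Gal(K⟮ζ⟯/K) :=
    (IsCyclotomicExtension.autEquivPow K⟮ζ⟯ hirr).isCyclic.2 inferInstance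
  rw [← lift_restrict hE, ← lift_restrict hF]
  congr 1
  apply IntermediateField.eq_of_finrank_eq_of_isCyclic
  rw [← (restrictAlgEquiv hE).toLinearEquiv.finrank_eq,
    ← (restrictAlgEquiv hF).toLinearEquiv.finrank_eq, h]

theorem ZMod.exists_pow_four_eq_neg_one {p : ℕ} [Fact p.Prime] (hp8 : p % 8 = 1) :
    ∃ u : ZMod p, u ^ 4 = -1 := by
  have hp := (Fact.out : p.Prime)
  obtain ⟨g, hg⟩ := IsCyclic.exists_ofOrder_eq_natCard (α := (ZMod p)ˣ)
  rw [Nat.card_eq_fintype_card, ZMod.card_units] at hg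
  have hd : 8 ∣ p - 1 := by have := hp.pos; omega
  have ho : orderOf (g ^ ((p - 1) / 8)) = 8 := by
    rw [← hg]
    refine orderOf_pow_orderOf_div ?_ (hg ▸ hd)
    have := hp.two_le; omega
  refine ⟨((g ^ ((p - 1) / 8) : (ZMod p)ˣ) : ZMod p), ?_⟩
  generalize g ^ ((p - 1) / 8) = w at ho
  have h8 : w ^ 8 = 1 := ho ▸ pow_orderOf_eq_one w
  have h4 : w ^ 4 ≠ 1 := fun h ↦ by
    have := orderOf_dvd_of_pow_eq_one h
    rw [ho] at this
    omega
  have h8' : (w : ZMod p) ^ 4 * (w : ZMod p) ^ 4 = 1 := by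
    rw [← pow_add, ← Units.val_pow_eq_pow_val, h8, Units.val_one]
  rcases mul_self_eq_one_iff.1 h8' with h | h
  · exact absurd (Units.ext (by simpa using h)) h4
  · exact h

theorem MulChar.conj_jacobiSum {F : Type*} [CommRing F] [Fintype F] (χ φ : MulChar F ℂ) :
    starRingEnd ℂ (jacobiSum χ φ) = jacobiSum χ⁻¹ φ⁻¹ := by
  have h (χ : MulChar F ℂ) : χ.ringHomComp (starRingEnd ℂ) = χ⁻¹ :=
    MulChar.ext' fun a ↦ MulChar.star_apply' χ a
  rw [← jacobiSum_ringHomComp, h, h]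

theorem Complex.exists_int_of_mem_adjoin_I {z : ℂ} (hz : z ∈ Algebra.adjoin ℤ {Complex.I}) :
    ∃ x y : ℤ, z = x + y * Complex.I := by
  induction hz using Algebra.adjoin_induction with
  | mem x hx => exact ⟨0, 1, by simpa using hx⟩
  | algebraMap r => exact ⟨r, 0, by simp⟩
  | add z w _ _ hz hw =>
    obtain ⟨x, y, rfl⟩ := hz
    obtain ⟨x', y', rfl⟩ := hw
    exact ⟨x + x', y + y', by push_cast; ring⟩
  | mul z w _ _ hz hw =>
    obtain ⟨x, y, rfl⟩ := hz
    obtain ⟨x', y', rfl⟩ := hw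
    refine ⟨x * x' - y * y', x * y' + y * x', ?_⟩
    push_cast
    linear_combination (y * y' : ℂ) * Complex.I_sq

theorem exists_jacobiSum_eq_of_orderOf_eq_four {p : ℕ} [Fact p.Prime] {χ : MulChar (ZMod p) ℂ}
    (hχ : orderOf χ = 4) :
    ∃ a b : ℤ, a ^ 2 + b ^ 2 = p ∧ Even b ∧ jacobiSum χ χ = a + b * Complex.I ∧
      jacobiSum χ⁻¹ χ⁻¹ = a - b * Complex.I := by
  have hχ4 : χ ^ 4 = 1 := hχ ▸ pow_orderOf_eq_one χ
  have hμ : IsPrimitiveRoot Complex.I 4 := Complex.isPrimitiveRoot_I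
  have hd : 4 ∣ Fintype.card (ZMod p) - 1 := hχ ▸ χ.orderOf_dvd_card_sub_one
  obtain ⟨z, hz, hJ⟩ := exists_jacobiSum_eq_neg_one_add (by norm_num) hχ4 hχ4 hd hμ
  obtain ⟨x, y, rfl⟩ := Complex.exists_int_of_mem_adjoin_I hz
  have hJ1 : jacobiSum χ χ = (-1 + 2 * y : ℤ) + (-2 * x : ℤ) * Complex.I := by
    rw [hJ]; push_cast
    linear_combination (x + y * Complex.I - 2 * y : ℂ) * Complex.I_sq
  have hJ2 : jacobiSum χ⁻¹ χ⁻¹ = (-1 + 2 * y : ℤ) - (-2 * x : ℤ) * Complex.I := by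
    rw [← MulChar.conj_jacobiSum, hJ1]
    simp only [map_add, map_mul, Complex.conj_I, map_intCast]
    ring
  refine ⟨-1 + 2 * y, -2 * x, ?_, ⟨-x, by ring⟩, hJ1, hJ2⟩
  have hne (n : ℕ) (h0 : n ≠ 0) (h : n < 4) : χ ^ n ≠ 1 :=
    pow_ne_one_of_lt_orderOf h0 (hχ ▸ h)
  have h1 : χ ≠ 1 := by simpa using hne 1 (by norm_num) (by norm_num)
  have h2 : χ * χ ≠ 1 := by simpa [sq] using hne 2 (by norm_num) (by norm_num)
  have hp := jacobiSum_mul_jacobiSum_inv (F := ZMod p) (F' := ℂ)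
    (by rw [ringChar.eq_zero, ZMod.ringChar_zmod_n]; exact (Fact.out : p.Prime).ne_zero.symm)
    h1 h1 h2
  rw [hJ1, hJ2, ZMod.card] at hp
  have : (((-1 + 2 * y) ^ 2 + (-2 * x) ^ 2 : ℤ) : ℂ) = ((p : ℤ) : ℂ) := by
    push_cast at hp ⊢
    linear_combination hp + (4 * x ^ 2 : ℂ) * Complex.I_sq
  exact_mod_cast this

theorem exists_mem_adjoin_sq_eq_of_mod_eight_eq_one {p : ℕ} (hp : p.Prime) (hp8 : p % 8 = 1)
    {ζ : ℂ} (hζ : IsPrimitiveRoot ζ p) :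
    ∃ a b : ℤ, a ^ 2 + b ^ 2 = p ∧ Even b ∧
      ∃ θ ∈ IntermediateField.adjoin ℚ {ζ}, θ ^ 2 = 2 * p + 2 * a * (Real.sqrt p : ℂ) := by
  have : Fact p.Prime := ⟨hp⟩
  have hμ : IsPrimitiveRoot Complex.I 4 := Complex.isPrimitiveRoot_I
  obtain ⟨χ, hχ⟩ := MulChar.exists_mulChar_orderOf (ZMod p) (n := 4)
    (by rw [ZMod.card]; omega) hμ
  have hχ4 : χ ^ 4 = 1 := hχ ▸ pow_orderOf_eq_one χ
  obtain ⟨u, hu⟩ := ZMod.exists_pow_four_eq_neg_one hp8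
  have hu0 : IsUnit u := by
    rw [isUnit_iff_ne_zero]; rintro rfl; norm_num at hu
  have hneg : χ (-1) = 1 := by
    rw [← hu, map_pow, ← MulChar.pow_apply' _ (by norm_num), hχ4, MulChar.one_apply hu0]
  have hne (n : ℕ) (h0 : n ≠ 0) (h : n < 4) : χ ^ n ≠ 1 :=
    pow_ne_one_of_lt_orderOf h0 (hχ ▸ h)
  have h1 : χ ≠ 1 := by simpa using hne 1 (by norm_num) (by norm_num)
  have h2 : χ ^ 2 ≠ 1 := hne 2 (by norm_num) (by norm_num)
  have hinv : χ⁻¹ = χ ^ 3 := inv_eq_of_mul_eq_one_right (by rw [← pow_succ', hχ4])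
  have hinv2 : χ⁻¹ * χ⁻¹ = χ ^ 2 := by
    rw [hinv, ← pow_add, show 3 + 3 = 4 + 2 from rfl, pow_add, hχ4, one_mul]
  set ψ : AddChar (ZMod p) ℂ := AddChar.zmodChar p hζ.pow_eq_one with hψdef
  have hψ : ψ.IsPrimitive := AddChar.zmodChar_primitive_of_primitive_root p hζ
  obtain ⟨a, b, hab, hb, hJ1, hJ2⟩ := exists_jacobiSum_eq_of_orderOf_eq_four hχ
  have hGH : gaussSum χ ψ * gaussSum χ⁻¹ ψ = p := by
    have := gaussSum_mul_gaussSum_pow_orderOf_sub_one h1 hψ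
    rwa [hχ, hneg, one_mul, ZMod.card, ← hinv] at this
  have hG := jacobiSum_mul_nontrivial (χ := χ) (φ := χ) (by rwa [← sq]) ψ
  have hH := jacobiSum_mul_nontrivial (χ := χ⁻¹) (φ := χ⁻¹) (by rwa [hinv2]) ψ
  rw [← sq, hJ1] at hG
  rw [hinv2, hJ2] at hH
  have hsq : ((Real.sqrt p : ℝ) : ℂ) ^ 2 = p := by
    rw [← Complex.ofReal_pow, Real.sq_sqrt p.cast_nonneg, Complex.ofReal_natCast]
  have hg2 : gaussSum (χ ^ 2) ψ ^ 2 = p := by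
    rw [gaussSum_sq h2 ((MulChar.isQuadratic_iff_sq_eq_one).2 (by rw [← pow_mul, hχ4])) hψ,
      MulChar.pow_apply' _ two_ne_zero, hneg, one_pow, one_mul, ZMod.card]
  have hθ : gaussSum χ ψ + gaussSum χ⁻¹ ψ ∈ IntermediateField.adjoin ℚ {ζ} := by
    rw [gaussSum, gaussSum, ← Finset.sum_add_distrib]
    refine sum_mem fun x _ ↦ ?_
    rw [← add_mul]
    refine mul_mem ?_ ?_
    · rw [hinv, MulChar.pow_apply' _ three_ne_zero]
      have h5 : χ x ^ 4 * χ x = χ x := by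
        rw [← MulChar.pow_apply' _ four_ne_zero, ← MulChar.mul_apply, hχ4, one_mul]
      have h6 : χ x * (χ x - 1) * (χ x + 1) * (χ x ^ 2 + 1) = 0 := by linear_combination h5
      simp only [mul_eq_zero] at h6
      rcases h6 with ((h | h) | h) | h
      · simp [h, zero_mem]
      · rw [sub_eq_zero.1 h, one_pow]; exact add_mem (one_mem _) (one_mem _)
      · rw [eq_neg_of_add_eq_zero_left h]
        exact add_mem (neg_mem (one_mem _)) (pow_mem (neg_mem (one_mem _)) _)
      · rw [show χ x + χ x ^ 3 = 0 by linear_combination χ x * h]; exact zero_mem _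
    · rw [hψdef, AddChar.zmodChar_apply]
      exact pow_mem (IntermediateField.mem_adjoin_simple_self ℚ ζ) _
  have hfin : (gaussSum χ ψ + gaussSum χ⁻¹ ψ) ^ 2 = 2 * p + 2 * a * gaussSum (χ ^ 2) ψ := by
    linear_combination 2 * hGH - hG - hH
  rcases sq_eq_sq_iff_eq_or_eq_neg.1 (hg2.trans hsq.symm) with h | h
  · exact ⟨a, b, hab, hb, _, hθ, by rw [hfin, h]⟩
  · exact ⟨-a, b, by rw [neg_sq, hab], hb, _, hθ, by rw [hfin, h]; push_cast; ring⟩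

theorem Int.emod_two_of_sq_sub_mul_sq_eq_neg_one {p : ℕ} (hp8 : p % 8 = 1) {u v : ℤ}
    (huv : u ^ 2 - p * v ^ 2 = -1) : u % 2 = 0 ∧ v % 2 = 1 := by
  obtain ⟨q, hq⟩ : ∃ q : ℤ, (p : ℤ) = 8 * q + 1 := ⟨p / 8, by omega⟩
  rw [hq] at huv
  rcases Int.emod_two_eq_zero_or_one u with hu | hu <;>
    rcases Int.emod_two_eq_zero_or_one v with hv | hv <;>
    refine ⟨?_, ?_⟩ <;> try assumption
  all_goals
    exfalso
    obtain ⟨m, hm⟩ : ∃ m, u = 2 * m + u % 2 := ⟨u / 2, by omega⟩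
    obtain ⟨n, hn⟩ : ∃ n, v = 2 * n + v % 2 := ⟨v / 2, by omega⟩
    rw [hu] at hm
    rw [hv] at hn
    subst hm hn
    ring_nf at huv
    omega

theorem exists_eq_sq_or_eq_mul_sq {p : ℕ} (hp : p.Prime) (hp8 : p % 8 = 1) {a b u v : ℤ}
    (hab : a ^ 2 + b ^ 2 = p) (hb : Even b) (huv : u ^ 2 - p * v ^ 2 = -1)
    (hpos : 0 ≤ u * a + v * p + b) :
    ∃ x : ℤ, x ≠ 0 ∧ (u * a + v * p + b = x ^ 2 ∨ u * a + v * p + b = p * x ^ 2) := by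
  obtain ⟨hu, hv⟩ := Int.emod_two_of_sq_sub_mul_sq_eq_neg_one hp8 huv
  have hb2 : b % 2 = 0 := Int.even_iff.1 hb
  set s := u * a + v * p with hs
  set t := u + v * a with ht
  have hs2 : s % 2 = 1 := by
    have : (p : ℤ) % 2 = 1 := by omega
    rw [hs]; simp [Int.add_emod, Int.mul_emod, hu, hv, this]
  have hprod : (s + b) * (s - b) = p * t ^ 2 := by
    rw [hs, ht]
    linear_combination (u ^ 2 - p * v ^ 2) * hab - b ^ 2 * huv
  have hst : v * s - u * t = 1 := by rw [hs, ht]; linear_combination -huv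
  have hcop : IsCoprime (s + b) (s - b) := by
    rw [Int.isCoprime_iff_gcd_eq_one]
    by_contra hg
    obtain ⟨l, hl, hlg⟩ := Nat.exists_prime_and_dvd hg
    have h1 : (l : ℤ) ∣ s + b := (Int.natCast_dvd_natCast.2 hlg).trans (Int.gcd_dvd_left ..)
    have h2 : (l : ℤ) ∣ s - b := (Int.natCast_dvd_natCast.2 hlg).trans (Int.gcd_dvd_right ..)
    have hl' : Prime (l : ℤ) := Nat.prime_iff_prime_int.1 hl
    have hl2 : ¬ (l : ℤ) ∣ 2 := by
      intro h
      have : l = 2 := (Nat.prime_dvd_prime_iff_eq hl Nat.prime_two).1 (by exact_mod_cast h)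
      subst this
      omega
    have hls : (l : ℤ) ∣ s :=
      (hl'.dvd_or_dvd (show (l : ℤ) ∣ 2 * s by simpa [two_mul] using dvd_add h1 h2)).resolve_left
        hl2
    have hlb : (l : ℤ) ∣ b := by simpa using dvd_sub h1 hls
    have hlt : ¬ (l : ℤ) ∣ t := fun h ↦ hl'.not_dvd_one
      (hst ▸ dvd_sub (hls.mul_left v) (h.mul_left u))
    have hlp : (l : ℤ) ∣ p := by
      rcases hl'.dvd_or_dvd (hprod ▸ h1.mul_right (s - b)) with h | h
      · exact h
      · exact absurd (hl'.dvd_of_dvd_pow h) hlt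
    have hlp' : l = p := (Nat.prime_dvd_prime_iff_eq hl hp).1 (by exact_mod_cast hlp)
    subst hlp'
    have hla : (l : ℤ) ∣ a := hl'.dvd_of_dvd_pow (n := 2) <| by
      rw [show a ^ 2 = l - b ^ 2 by linear_combination hab]
      exact dvd_sub dvd_rfl (hlb.trans (dvd_pow_self b two_ne_zero))
    have hsq : (l : ℤ) * l ∣ l * 1 := by
      rw [mul_one]
      nth_rw 3 [← hab]
      rw [← sq]
      exact dvd_add (pow_dvd_pow_of_dvd hla 2) (pow_dvd_pow_of_dvd hlb 2)
    exact hl'.not_dvd_one (Int.dvd_of_mul_dvd_mul_left hl'.ne_zero hsq)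
  have hne : s + b ≠ 0 := fun h ↦ by omega
  have hp0 : (p : ℤ) ≠ 0 := by exact_mod_cast hp.ne_zero
  have hsquare (q r : ℤ) (hqr : IsCoprime q r) (hq : 0 ≤ q) (h : q * r = t ^ 2) :
      ∃ x, q = x ^ 2 := by
    obtain ⟨x, hx | hx⟩ := Int.sq_of_isCoprime hqr h
    · exact ⟨x, hx⟩
    · exact ⟨0, by nlinarith [sq_nonneg x]⟩
  rcases (Nat.prime_iff_prime_int.1 hp).dvd_or_dvd (hprod ▸ dvd_mul_right (p : ℤ) (t ^ 2)) with
    ⟨q, hq⟩ | ⟨q, hq⟩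
  · have hq0 : 0 ≤ q := by
      have : (0 : ℤ) < p := by exact_mod_cast hp.pos
      rw [hq] at hpos
      exact nonneg_of_mul_nonneg_right hpos this
    obtain ⟨x, rfl⟩ := hsquare q (s - b) (by rw [hq] at hcop; exact hcop.of_mul_left_right) hq0
      (mul_left_cancel₀ hp0 (by rw [← hprod, hq]; ring))
    exact ⟨x, by rintro rfl; simp [hq] at hne, Or.inr hq⟩
  · obtain ⟨x, hx⟩ := hsquare (s + b) q (by rw [hq] at hcop; exact hcop.of_mul_right_right) hpos
      (mul_left_cancel₀ hp0 (by rw [← hprod, hq]; ring))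
    exact ⟨x, by rintro rfl; simp [hx] at hne, Or.inl hx⟩

theorem IntermediateField.exists_basis_adjoin_simple_of_sq_eq {K L : Type*} [Field K] [Field L]
    [Algebra K L] {s : L} {d : K} (hs : s ^ 2 = algebraMap K L d) (hd : ¬ IsSquare d) :
    ∃ b : Module.Basis (Fin 2) K K⟮s⟯, b 0 = 1 ∧ b 1 = AdjoinSimple.gen K s := by
  have hirr : Irreducible (Polynomial.X ^ 2 - Polynomial.C d) :=
    X_pow_sub_C_irreducible_of_prime Nat.prime_two fun x hx ↦ hd ⟨x, by rw [← hx, sq]⟩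
  have hmin : minpoly K s = Polynomial.X ^ 2 - Polynomial.C d :=
    (minpoly.eq_of_irreducible_of_monic hirr (by simp [hs])
      (Polynomial.monic_X_pow_sub_C d two_ne_zero)).symm
  have hint : IsIntegral K s :=
    ⟨_, Polynomial.monic_X_pow_sub_C d two_ne_zero, by simp [hs]⟩
  have hdim : (adjoin.powerBasis hint).dim = 2 := by
    rw [adjoin.powerBasis_dim, hmin, Polynomial.natDegree_X_pow_sub_C]
  exact ⟨(adjoin.powerBasis hint).basis.reindex (finCongr hdim), by simp, by simp⟩

theorem Algebra.norm_trace_of_basis_of_sq_eq {K S : Type*} [Field K] [CommRing S]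
    [Algebra K S] (b : Module.Basis (Fin 2) K S) {d : K} (h0 : b 0 = 1)
    (h1 : b 1 * b 1 = algebraMap K S d) (x y : K) :
    Algebra.norm K (algebraMap K S x + algebraMap K S y * b 1) = x ^ 2 - d * y ^ 2 ∧
      Algebra.trace K S (algebraMap K S x + algebraMap K S y * b 1) = 2 * x := by
  have e0 : (algebraMap K S x + algebraMap K S y * b 1) * b 0 = x • b 0 + y • b 1 := by
    rw [h0, mul_one, Algebra.smul_def, Algebra.smul_def, mul_one]
  have e1 : (algebraMap K S x + algebraMap K S y * b 1) * b 1 = (y * d) • b 0 + x • b 1 := by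
    rw [h0, Algebra.smul_def, Algebra.smul_def, mul_one, map_mul]
    linear_combination algebraMap K S y * h1
  rw [Algebra.norm_eq_matrix_det b, Algebra.trace_eq_matrix_trace b, Matrix.det_fin_two,
    Matrix.trace_fin_two]
  refine ⟨?_, ?_⟩ <;> simp [Algebra.leftMulMatrix_eq_repr_mul, e0, e1] <;> ring

theorem Int.exists_eq_of_prime_mul_sq_eq {p : ℕ} (hp : p.Prime) {r : ℚ} {n : ℤ}
    (h : p * r ^ 2 = n) : ∃ m : ℤ, r = m := by
  have hint : IsIntegral ℤ ((p : ℚ) * r) := by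
    refine IsIntegral.of_pow two_pos ?_
    rw [show ((p : ℚ) * r) ^ 2 = algebraMap ℤ ℚ (p * n) by
      simp; linear_combination (p : ℚ) * h]
    exact isIntegral_algebraMap
  obtain ⟨N, hN⟩ := IsIntegrallyClosed.isIntegral_iff.1 hint
  have hN' : (N : ℚ) = p * r := by simpa using hN
  have hsq : N ^ 2 = p * n := by
    have : (N : ℚ) ^ 2 = p * n := by rw [hN']; linear_combination (p : ℚ) * h
    exact_mod_cast this
  obtain ⟨m, rfl⟩ := (Nat.prime_iff_prime_int.1 hp).dvd_of_dvd_pow (Dvd.intro _ hsq.symm)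
  have hp0 : (p : ℚ) ≠ 0 := by exact_mod_cast hp.ne_zero
  exact ⟨m, mul_left_cancel₀ hp0 (by rw [← hN']; push_cast; rfl)⟩

/-- In `ℚ(√p)` with `p ≡ 1 (mod 8)`, the integers of norm `-1` lie in `ℤ[√p]`. -/
theorem exists_int_eq_of_isIntegral_of_norm_eq_neg_one {p : ℕ} (hp : p.Prime) (hp8 : p % 8 = 1)
    {S : Type*} [Field S] [Algebra ℚ S] (b : Module.Basis (Fin 2) ℚ S) (h0 : b 0 = 1)
    (h1 : b 1 * b 1 = p) {e : S} (he : IsIntegral ℤ e) (hn : Algebra.norm ℚ e = -1) :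
    ∃ u v : ℤ, u ^ 2 - p * v ^ 2 = -1 ∧ e = u + v * b 1 := by
  obtain ⟨x, y, rfl⟩ : ∃ x y : ℚ, e = algebraMap ℚ S x + algebraMap ℚ S y * b 1 :=
    ⟨b.repr e 0, b.repr e 1, by
      conv_lhs => rw [← b.sum_repr e]
      rw [Fin.sum_univ_two, h0, Algebra.smul_def, Algebra.smul_def, mul_one]⟩
  obtain ⟨hN, hT⟩ := Algebra.norm_trace_of_basis_of_sq_eq b h0 (d := p) (by simpa using h1) x y
  rw [hN] at hn
  have := Module.Finite.of_basis b
  have hTint := Algebra.isIntegral_trace (L := ℚ) he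
  rw [hT] at hTint
  obtain ⟨m, hm⟩ := IsIntegrallyClosed.isIntegral_iff.1 hTint
  have hm' : 2 * x = m := by simpa using hm.symm
  obtain ⟨n, hn'⟩ := Int.exists_eq_of_prime_mul_sq_eq hp (r := 2 * y) (n := m ^ 2 + 4)
    (by push_cast; rw [← hm']; linear_combination -4 * hn)
  have hmn : m ^ 2 - p * n ^ 2 = -4 := by
    have : (m : ℚ) ^ 2 - p * n ^ 2 = -4 := by rw [← hm', ← hn']; linear_combination 4 * hn
    exact_mod_cast this
  have hpar : m % 2 = 0 ∧ n % 2 = 0 := by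
    obtain ⟨q, hq⟩ : ∃ q : ℤ, (p : ℤ) = 8 * q + 1 := ⟨p / 8, by omega⟩
    rw [hq] at hmn
    rcases Int.emod_two_eq_zero_or_one m with hu | hu <;>
      rcases Int.emod_two_eq_zero_or_one n with hv | hv <;>
      refine ⟨?_, ?_⟩ <;> try assumption
    all_goals
      exfalso
      obtain ⟨i, hi⟩ : ∃ i, m = 2 * i + m % 2 := ⟨m / 2, by omega⟩
      obtain ⟨j, hj⟩ : ∃ j, n = 2 * j + n % 2 := ⟨n / 2, by omega⟩
      rw [hu] at hi
      rw [hv] at hj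
      have hi2 := Int.even_iff.1 (Int.even_mul_succ_self i)
      have hj2 := Int.even_iff.1 (Int.even_mul_succ_self j)
      rw [hi, hj] at hmn
      ring_nf at hmn hi2 hj2
      omega
  obtain ⟨u, rfl⟩ := Int.dvd_of_emod_eq_zero hpar.1
  obtain ⟨v, rfl⟩ := Int.dvd_of_emod_eq_zero hpar.2
  have hx : x = u := by push_cast at hm'; linarith
  have hy : y = v := by push_cast at hn'; linarith
  subst hx hy
  exact ⟨u, v, by linarith, by simp⟩

/-- **Theorem 4.**  Let `p` be a prime with `p ≡ 1 (mod 8)`, `k = ℚ(√p)` (inside `ℂ`), and `ε`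
a unit of the ring of integers of `k` which is positive in the real embedding sending `√p` to
the positive square root, with `N_{k/ℚ}(ε) = −1`.  Then the quartic subfield `F` of `ℚ(μ_p)`
(inside `ℂ`) equals `k(√(ε√p))`, the quadratic extension of `k` obtained by adjoining a square
root `c` of `ε√p`. -/
theorem quartic_cyclotomic_subfield_eq_adjoin_sqrt_unit_mul_sqrt_p
    (p : ℕ) (hp : p.Prime) (hp8 : p % 8 = 1)
    (k : IntermediateField ℚ ℂ) (hk : k = ℚ⟮(Real.sqrt p : ℂ)⟯) [NumberField k]
    (ε : (𝓞 k)ˣ)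
    (hεpos : ∃ r : ℝ, 0 < r ∧ (((ε : 𝓞 k) : k) : ℂ) = r)
    (hεnorm : Algebra.norm ℚ ((ε : 𝓞 k) : k) = -1)
    (ζ : ℂ) (hζ : IsPrimitiveRoot ζ p)
    (F : IntermediateField ℚ ℂ) (hFle : F ≤ ℚ⟮ζ⟯) (hF4 : Module.finrank ℚ F = 4)
    (c : ℂ) (hc : c ^ 2 = (((ε : 𝓞 k) : k) : ℂ) * Real.sqrt p) :
    IntermediateField.restrictScalars ℚ (IntermediateField.adjoin k {c}) = F := by
  have hp0 : (p : ℂ) ≠ 0 := by exact_mod_cast hp.ne_zero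
  set s : ℂ := (Real.sqrt p : ℂ) with hs
  have hs2 : s ^ 2 = p := by
    rw [hs, ← Complex.ofReal_pow, Real.sq_sqrt p.cast_nonneg, Complex.ofReal_natCast]
  have hs0 : s ≠ 0 := by rintro h; rw [h] at hs2; exact hp0 (by simpa using hs2.symm)
  have hpsq : ¬ IsSquare (p : ℚ) := fun h ↦
    hp.prime.irreducible.not_isSquare (Rat.isSquare_natCast_iff.1 h)
  obtain ⟨B, hB0, hB1⟩ : ∃ B : Module.Basis (Fin 2) ℚ k, B 0 = 1 ∧ ((B 1 : k) : ℂ) = s := by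
    subst hk
    obtain ⟨B, hB0, hB1⟩ := exists_basis_adjoin_simple_of_sq_eq (s := s) (d := (p : ℚ))
      (by simpa using hs2) hpsq
    exact ⟨B, hB0, by rw [hB1, AdjoinSimple.coe_gen]⟩
  have hB11 : B 1 * B 1 = (p : k) := Subtype.ext (by simpa [hB1, ← sq] using hs2)
  obtain ⟨u, v, huv, he⟩ := exists_int_eq_of_isIntegral_of_norm_eq_neg_one hp hp8 B hB0 hB11
    (RingOfIntegers.isIntegral_coe (ε : 𝓞 k)) hεnorm
  have heC : (((ε : 𝓞 k) : k) : ℂ) = u + v * s := (congrArg Subtype.val he).trans (by simp [hB1])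
  obtain ⟨a, b, hab, hb, θ, hθmem, hθ⟩ := exists_mem_adjoin_sq_eq_of_mod_eight_eq_one hp hp8 hζ
  have hc4 : Module.finrank ℚ (restrictScalars ℚ (adjoin k {c})) = 4 := by
    have hd : ¬ IsSquare (((ε : 𝓞 k) : k) * B 1) := by
      rintro ⟨w, hw⟩
      have hN := congrArg (Algebra.norm ℚ) hw
      have hNB := (Algebra.norm_trace_of_basis_of_sq_eq B hB0 (d := (p : ℚ)) (by simpa using hB11)
        0 1).1
      simp only [map_zero, map_one, zero_add, one_mul] at hNB
      rw [map_mul, map_mul, hεnorm, hNB] at hN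
      exact hpsq ⟨_, by rw [← hN]; ring⟩
    obtain ⟨C, -, -⟩ := exists_basis_adjoin_simple_of_sq_eq (K := k) (s := c) (hc.trans (by
      rw [map_mul, ← hB1]; rfl)) hd
    have h1 := Module.finrank_eq_card_basis B
    have h2 := Module.finrank_eq_card_basis C
    have h3 := Module.finrank_mul_finrank ℚ k (adjoin k {c})
    rw [h1, h2, Fintype.card_fin] at h3
    exact h3.symm
  refine hζ.eq_of_le_adjoin_of_finrank_eq hp (Polynomial.cyclotomic.irreducible_rat hp.pos) ?_ hFle
    (hc4.trans hF4.symm)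
  have hb0 : b ≠ 0 := by
    rintro rfl
    exact (Nat.prime_iff_prime_int.1 hp).irreducible.not_isSquare ⟨a, by rw [← hab]; ring⟩
  have ha0 : a ≠ 0 := by
    rintro rfl
    exact (Nat.prime_iff_prime_int.1 hp).irreducible.not_isSquare ⟨b, by rw [← hab]; ring⟩
  have hsζ : s ∈ ℚ⟮ζ⟯ := by
    have ha0' : (a : ℂ) ≠ 0 := by exact_mod_cast ha0
    rw [show s = (θ ^ 2 - 2 * p) / (2 * a) by rw [hθ]; field_simp; ring]
    exact div_mem (sub_mem (pow_mem hθmem 2) (mul_mem (_root_.ofNat_mem _ 2) (_root_.natCast_mem _ p)))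
      (mul_mem (_root_.ofNat_mem _ 2) (_root_.intCast_mem _ a))
  have hpos : 0 ≤ u * a + v * p + b := by
    obtain ⟨r, hr, hre⟩ := hεpos
    have hr' : r = u + v * Real.sqrt p := by
      rw [heC, hs] at hre; exact_mod_cast hre.symm
    have hR2 : Real.sqrt p ^ 2 = p := Real.sq_sqrt p.cast_nonneg
    have hab' : (a : ℝ) ^ 2 + b ^ 2 = p := by exact_mod_cast hab
    have huv' : (u : ℝ) ^ 2 - p * v ^ 2 = -1 := by exact_mod_cast huv
    have hbR : 0 < (b : ℝ) ^ 2 := by positivity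
    have haR : 0 < a + Real.sqrt p := by
      have := Real.neg_sqrt_lt_of_sq_lt (show (a : ℝ) ^ 2 < p by linarith)
      linarith
    have hkey : 2 * (r * (a + Real.sqrt p)) * (u * a + v * p + b) =
        (u * a + v * p + b + (u + v * a) * Real.sqrt p) ^ 2 := by
      rw [hr']
      generalize Real.sqrt p = R at hR2
      rw [← hR2] at hab' huv' ⊢
      linear_combination (u ^ 2 - R ^ 2 * v ^ 2 : ℝ) * hab' - (b : ℝ) ^ 2 * huv'
    have : (0 : ℝ) ≤ u * a + v * p + b :=
      nonneg_of_mul_nonneg_right (hkey ▸ sq_nonneg _) (by positivity)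
    exact_mod_cast this
  obtain ⟨r, hrmem, hr0, hr⟩ : ∃ r ∈ ℚ⟮ζ⟯, r ≠ 0 ∧ r ^ 2 = (u * a + v * p + b : ℂ) := by
    obtain ⟨x, hx0, hx | hx⟩ := exists_eq_sq_or_eq_mul_sq hp hp8 hab hb huv hpos
    · exact ⟨x, _root_.intCast_mem _ x, by exact_mod_cast hx0, by exact_mod_cast hx.symm⟩
    · refine ⟨s * x, mul_mem hsζ (_root_.intCast_mem _ x), mul_ne_zero hs0 (by exact_mod_cast hx0), ?_⟩
      rw [mul_pow, hs2]
      exact_mod_cast hx.symm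
  have hθ0 : θ ≠ 0 := by
    rintro rfl
    have h : (p : ℂ) ^ 2 = a ^ 2 * p := by
      linear_combination (a * s - p : ℂ) / 2 * hθ + (a : ℂ) ^ 2 * hs2
    have h' : (p : ℤ) * p = p * a ^ 2 := by
      have : (p : ℤ) ^ 2 = a ^ 2 * p := by exact_mod_cast h
      linarith
    have := mul_left_cancel₀ (by exact_mod_cast hp.ne_zero) h'
    exact hb0 (pow_eq_zero_iff two_ne_zero |>.1 (by linarith))
  have hsq : (c * (θ * r)) ^ 2 = (s * (u * a + v * p + b + (u + v * a) * s)) ^ 2 := by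
    have hab' : (a : ℂ) ^ 2 + b ^ 2 = p := by exact_mod_cast hab
    have huv' : (u : ℂ) ^ 2 - p * v ^ 2 = -1 := by exact_mod_cast huv
    rw [mul_pow, mul_pow, hc, hθ, hr, heC]
    rw [← hs2] at hab' huv' ⊢
    linear_combination s ^ 2 * ((u ^ 2 - s ^ 2 * v ^ 2 : ℂ) * hab' - (b : ℂ) ^ 2 * huv')
  have hmem : s * (u * a + v * p + b + (u + v * a) * s) ∈ ℚ⟮ζ⟯ := by
    have h (n : ℤ) : (n : ℂ) ∈ ℚ⟮ζ⟯ := _root_.intCast_mem _ n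
    have h' := _root_.natCast_mem ℚ⟮ζ⟯ p
    exact mul_mem hsζ (add_mem (add_mem (add_mem (mul_mem (h u) (h a)) (mul_mem (h v) h')) (h b))
      (mul_mem (add_mem (h u) (mul_mem (h v) (h a))) hsζ))
  have hcζ : c ∈ ℚ⟮ζ⟯ := by
    have hθr : θ * r ≠ 0 := mul_ne_zero hθ0 hr0
    rw [← mul_div_cancel_right₀ c hθr]
    refine div_mem ?_ (mul_mem hθmem hrmem)
    rcases sq_eq_sq_iff_eq_or_eq_neg.1 hsq with h | h
    · exact h ▸ hmem
    · exact h ▸ neg_mem hmem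
  have hkζ : k ≤ ℚ⟮ζ⟯ := by
    rw [hk, adjoin_simple_le_iff]
    exact hsζ
  have hle : adjoin k {c} ≤ extendScalars hkζ := adjoin_simple_le_iff.2 hcζ
  exact fun x hx ↦ hle hx
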